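/- arXiv:2103.13533 — 3 statements merged into one kernel-verified Lean document; each statement's English description precedes it below -/
import Mathlib

section
/- Let U be an open subset of ℝⁿ, let F : U → ℝ be Lipschitz continuous, and let γ : [0,1] → U be a continuously differentiable path such that F is differentiable at γ(t) for almost every t ∈ [0,1]. Then ∫₀¹ ∇F(γ(t)) · γ′(t) dt = F(γ(1)) − F(γ(0)). -/
open Set MeasureTheory

/-- **Gradient theorem for Lipschitz continuous functions.**
If `U ⊆ ℝⁿ` is open, `F` is Lipschitz continuous on `U`, and `γ : [0,1] → U` is a
continuously differentiable path such that `F` is differentiable at `γ t` for almost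
every `t ∈ [0,1]`, then `∫₀¹ ∇F(γ(t)) ⬝ γ'(t) dt = F(γ(1)) - F(γ(0))`. -/
theorem gradient_theorem_lipschitz {n : ℕ}
    (U : Set (EuclideanSpace ℝ (Fin n))) (hU : IsOpen U)
    (F : EuclideanSpace ℝ (Fin n) → ℝ) (K : NNReal) (hF : LipschitzOnWith K F U)
    (γ : ℝ → EuclideanSpace ℝ (Fin n))
    (hγU : ∀ t ∈ Icc (0:ℝ) 1, γ t ∈ U)
    (hγ : ContDiffOn ℝ 1 γ (Icc (0:ℝ) 1))
    (hdiff : ∀ᵐ t ∂(volume.restrict (Icc (0:ℝ) 1)), DifferentiableAt ℝ F (γ t)) :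
    ∫ t in (0:ℝ)..1, fderiv ℝ F (γ t) (derivWithin γ (Icc (0:ℝ) 1) t)
      = F (γ 1) - F (γ 0) := by
  have hcont := hγ.continuousOn_derivWithin (uniqueDiffOn_Icc zero_lt_one) le_rfl
  obtain ⟨C, hC⟩ := isCompact_Icc.exists_bound_of_continuousOn hcont
  have hγL : LipschitzOnWith C.toNNReal γ (Icc (0:ℝ) 1) := by
    refine (convex_Icc (0:ℝ) 1).lipschitzOnWith_of_nnnorm_derivWithin_le
      (hγ.differentiableOn one_ne_zero) (fun t ht => ?_)
    rw [← norm_toNNReal]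
    exact Real.toNNReal_le_toNNReal (hC t ht)
  have hL : LipschitzOnWith (K * C.toNNReal) (F ∘ γ) (uIcc (0:ℝ) 1) := by
    rw [uIcc_of_le zero_le_one]
    exact hF.comp hγL hγU
  have key := hL.absolutelyContinuousOnInterval.integral_deriv_eq_sub
  simp only [Function.comp_apply] at key
  rw [← key]
  rw [ae_restrict_iff' measurableSet_Icc] at hdiff
  refine intervalIntegral.integral_congr_ae ?_
  have h1 : ∀ᵐ t : ℝ, t ≠ 1 := by simp [ae_iff]
  filter_upwards [hdiff, h1] with t ht ht1 hmem
  rw [uIoc_of_le zero_le_one] at hmem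
  have hI : Icc (0:ℝ) 1 ∈ nhds t := Icc_mem_nhds hmem.1 (lt_of_le_of_ne hmem.2 ht1)
  have htI : t ∈ Icc (0:ℝ) 1 := ⟨hmem.1.le, hmem.2⟩
  have hd : DifferentiableAt ℝ γ t :=
    (hγ.differentiableOn one_ne_zero t htI).differentiableAt hI
  rw [derivWithin_of_mem_nhds hI]
  exact ((ht htI).hasFDerivAt.comp_hasDerivAt t hd.hasDerivAt).deriv.symm
end

section
/- Let U be an open subset of ℝⁿ, let F : U → ℝ be Lipschitz continuous, let p, q ∈ U, and let γ(t) = p + t(q − p) be the straight-line path from p to q, assumed to lie in U. If F is differentiable at γ(t) for almost every t ∈ [0,1], then F(q) − F(p) = Σᵢ₌₁ⁿ IGᵢ, where IGᵢ = (qᵢ − pᵢ) ∫₀¹ (∂F/∂xᵢ)(γ(t)) dt (completeness of Integrated Gradients with straight-line paths). -/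
open Set MeasureTheory

/-- **Completeness of Integrated Gradients with straight-line paths.**
If `U ⊆ ℝⁿ` is open, `F` is Lipschitz continuous on `U`, `p, q ∈ U`, the straight-line
path `γ(t) = p + t(q - p)` lies in `U`, and `F` is differentiable at `γ t` for almost
every `t ∈ [0,1]`, then `F(q) - F(p) = ∑ i, IGᵢ` where
`IGᵢ = (qᵢ - pᵢ) ∫₀¹ (∂F/∂xᵢ)(γ(t)) dt`. -/
theorem integrated_gradients_completeness {n : ℕ}
    (U : Set (EuclideanSpace ℝ (Fin n))) (hU : IsOpen U)
    (F : EuclideanSpace ℝ (Fin n) → ℝ) (K : NNReal) (hF : LipschitzOnWith K F U)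
    (p q : EuclideanSpace ℝ (Fin n)) (hp : p ∈ U) (hq : q ∈ U)
    (hline : ∀ t ∈ Icc (0:ℝ) 1, p + t • (q - p) ∈ U)
    (hdiff : ∀ᵐ t ∂(volume.restrict (Icc (0:ℝ) 1)),
      DifferentiableAt ℝ F (p + t • (q - p))) :
    F q - F p = ∑ i : Fin n, (q i - p i) *
      ∫ t in (0:ℝ)..1, fderiv ℝ F (p + t • (q - p)) (EuclideanSpace.single i 1) := by
  have hγc : Continuous (fun t : ℝ => p + t • (q - p)) := by fun_prop
  have hint : ∀ i : Fin n, IntervalIntegrable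
      (fun t : ℝ => fderiv ℝ F (p + t • (q - p)) (EuclideanSpace.single i 1)) volume 0 1 := by
    intro i
    have hm : Measurable
        (fun t : ℝ => fderiv ℝ F (p + t • (q - p)) (EuclideanSpace.single i 1)) :=
      (measurable_fderiv_apply_const ℝ F (EuclideanSpace.single i (1:ℝ))).comp hγc.measurable
    refine (intervalIntegrable_const (c := (K : ℝ))).mono_fun hm.aestronglyMeasurable ?_
    rw [Filter.EventuallyLE, ae_restrict_iff' measurableSet_uIoc]
    refine Filter.Eventually.of_forall fun t ht => ?_
    rw [uIoc_of_le zero_le_one] at ht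
    have h1 : ‖fderiv ℝ F (p + t • (q - p))‖ ≤ K :=
      norm_fderiv_le_of_lipschitzOn ℝ (hU.mem_nhds (hline t ⟨ht.1.le, ht.2⟩)) hF
    have h2 := (fderiv ℝ F (p + t • (q - p))).le_opNorm (EuclideanSpace.single i (1:ℝ))
    have h3 : ‖(EuclideanSpace.single i (1:ℝ) : EuclideanSpace ℝ (Fin n))‖ = 1 := by simp
    rw [h3, mul_one] at h2
    exact h2.trans (h1.trans (le_abs_self _))
  have hγL : LipschitzOnWith ‖q - p‖₊ (fun t : ℝ => p + t • (q - p)) (uIcc 0 1) := by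
    refine LipschitzOnWith.of_dist_le_mul fun x _ y _ => ?_
    rw [dist_add_left, dist_eq_norm, ← sub_smul, norm_smul, mul_comm, dist_eq_norm, coe_nnnorm]
  have hL : LipschitzOnWith (K * ‖q - p‖₊) (fun t : ℝ => F (p + t • (q - p))) (uIcc 0 1) := by
    refine hF.comp hγL fun t ht => ?_
    rw [uIcc_of_le zero_le_one] at ht
    exact hline t ht
  have hftc := hL.absolutelyContinuousOnInterval.integral_deriv_eq_sub
  simp only [one_smul, zero_smul, add_zero, add_sub_cancel] at hftc
  rw [← hftc]
  simp_rw [← intervalIntegral.integral_const_mul]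
  rw [← intervalIntegral.integral_finsetSum fun i _ => (hint i).const_mul _]
  refine intervalIntegral.integral_congr_ae ?_
  rw [ae_restrict_iff' measurableSet_Icc] at hdiff
  filter_upwards [hdiff] with t ht h01
  rw [uIoc_of_le zero_le_one] at h01
  have hd := (ht ⟨h01.1.le, h01.2⟩).hasFDerivAt
  have hγd : HasDerivAt (fun t : ℝ => p + t • (q - p)) (q - p) t := by
    simpa using ((hasDerivAt_id t).smul_const (q - p)).const_add p
  refine (hd.comp_hasDerivAt t hγd).deriv.trans ?_
  have hdec : q - p = ∑ i : Fin n, (q i - p i) • EuclideanSpace.single i (1:ℝ) := by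
    ext j
    simp [Finset.sum_apply, Pi.single_apply]
  generalize fderiv ℝ F (p + t • (q - p)) = L
  conv_lhs => rw [hdec]
  simp [map_sum]
end

section
/- Let γ = (γ₁, γ₂) : [0,1] → ℝ² be a continuously differentiable path with γ(0) = (0,0), γ(1) = (1,1), both components monotonically increasing, and γ₂(t) ≤ γ₁(t) for all t ∈ [0,1], with strict inequality for some t. If γ₁ and γ₂ are strictly increasing, then for F(x₁,x₂) = x₁x₂ the attributions IG₁ = ∫₀¹ γ₂(t) γ₁′(t) dt and IG₂ = ∫₀¹ γ₁(t) γ₂′(t) dt satisfy IG₁ < IG₂; for the straight-line path γ(t) = (t,t) one has IG₁ = IG₂ = 1/2. -/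
open Set

/-- Let `γ = (γ₁, γ₂) : [0,1] → ℝ²` be a continuously differentiable path from `(0,0)` to
`(1,1)` with both components monotonically increasing, `γ₂ ≤ γ₁` on `[0,1]` with strict
inequality somewhere.  If `γ₁` and `γ₂` are strictly increasing on `[0,1]`, then for
`F(x₁,x₂) = x₁ x₂` the attributions `IG₁ = ∫₀¹ γ₂(t) γ₁'(t) dt` and
`IG₂ = ∫₀¹ γ₁(t) γ₂'(t) dt` satisfy `IG₁ < IG₂`; and for the straight-line path
`γ(t) = (t,t)` one has `IG₁ = IG₂ = 1/2`. -/
theorem ig_attributions_below_diagonal (γ₁ γ₂ : ℝ → ℝ)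
    (hγ₁ : ContDiffOn ℝ 1 γ₁ (Icc (0:ℝ) 1)) (hγ₂ : ContDiffOn ℝ 1 γ₂ (Icc (0:ℝ) 1))
    (h10 : γ₁ 0 = 0) (h20 : γ₂ 0 = 0) (h11 : γ₁ 1 = 1) (h21 : γ₂ 1 = 1)
    (hmono₁ : MonotoneOn γ₁ (Icc (0:ℝ) 1)) (hmono₂ : MonotoneOn γ₂ (Icc (0:ℝ) 1))
    (hle : ∀ t ∈ Icc (0:ℝ) 1, γ₂ t ≤ γ₁ t)
    (hlt : ∃ t ∈ Icc (0:ℝ) 1, γ₂ t < γ₁ t)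
    (hstrict₁ : StrictMonoOn γ₁ (Icc (0:ℝ) 1)) (hstrict₂ : StrictMonoOn γ₂ (Icc (0:ℝ) 1)) :
    ((∫ t in (0:ℝ)..1, γ₂ t * derivWithin γ₁ (Icc (0:ℝ) 1) t)
      < ∫ t in (0:ℝ)..1, γ₁ t * derivWithin γ₂ (Icc (0:ℝ) 1) t)
    ∧ (∫ t in (0:ℝ)..1, t * derivWithin (fun s : ℝ => s) (Icc (0:ℝ) 1) t) = 1/2 := by
  have hU : UniqueDiffOn ℝ (Icc (0:ℝ) 1) := uniqueDiffOn_Icc (by norm_num)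
  have c1 := hγ₁.continuousOn
  have c2 := hγ₂.continuousOn
  have d1 := hγ₁.continuousOn_derivWithin hU le_rfl
  have d2 := hγ₂.continuousOn_derivWithin hU le_rfl
  have hd : ∀ f : ℝ → ℝ, ContDiffOn ℝ 1 f (Icc (0:ℝ) 1) → ∀ x ∈ Ioo (0:ℝ) 1,
      HasDerivAt f (derivWithin f (Icc (0:ℝ) 1) x) x := by
    intro f hf x hx
    exact ((hf.differentiableOn one_ne_zero) x (Ioo_subset_Icc_self hx)).hasDerivWithinAt.hasDerivAt
      (Icc_mem_nhds hx.1 hx.2)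
  have ii : ∀ f : ℝ → ℝ, ContinuousOn f (Icc (0:ℝ) 1) →
      IntervalIntegrable f MeasureTheory.volume 0 1 := fun f hf =>
    hf.intervalIntegrable_of_Icc zero_le_one
  refine ⟨?_, ?_⟩
  · set g1 := derivWithin γ₁ (Icc (0:ℝ) 1) with hg1
    set g2 := derivWithin γ₂ (Icc (0:ℝ) 1) with hg2
    have e1 : ∫ t in (0:ℝ)..1, (g1 t * γ₂ t + γ₁ t * g2 t) = 1 := by
      rw [intervalIntegral.integral_eq_sub_of_hasDerivAt_of_le (f := fun t => γ₁ t * γ₂ t)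
        zero_le_one (c1.mul c2) (fun x hx => (hd _ hγ₁ x hx).mul (hd _ hγ₂ x hx))
        (ii _ ((d1.mul c2).add (c1.mul d2)))]
      simp [h10, h11, h21]
    have e2 : ∫ t in (0:ℝ)..1, (g1 t * γ₁ t + γ₁ t * g1 t) = 1 := by
      rw [intervalIntegral.integral_eq_sub_of_hasDerivAt_of_le (f := fun t => γ₁ t * γ₁ t)
        zero_le_one (c1.mul c1) (fun x hx => (hd _ hγ₁ x hx).mul (hd _ hγ₁ x hx))
        (ii _ ((d1.mul c1).add (c1.mul d1)))]
      simp [h10, h11]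
    have e3 : 0 < ∫ t in (0:ℝ)..1, (γ₁ t - γ₂ t) * g1 t := by
      apply intervalIntegral.integral_pos zero_lt_one ((c1.sub c2).mul d1)
      · intro x hx
        exact mul_nonneg (sub_nonneg.2 (hle x (Ioc_subset_Icc_self hx))) hmono₁.derivWithin_nonneg
      · obtain ⟨t, ht, hlt⟩ := hlt
        have ht1 : t < 1 := by
          rcases ht.2.lt_or_eq with h | h
          · exact h
          · subst h; linarith
        have ht0 : 0 < t := by
          rcases ht.1.lt_or_eq with h | h
          · exact h
          · subst h; linarith
        have hn : Icc (0:ℝ) 1 ∈ nhds t := Icc_mem_nhds ht0 ht1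
        have hev : ∀ᶠ x in nhds t, γ₂ x < γ₁ x :=
          (c2.continuousAt hn).eventually_lt (c1.continuousAt hn) hlt
        obtain ⟨ε, hε, hb⟩ := Metric.eventually_nhds_iff.1 hev
        obtain ⟨b, hb1, hb2⟩ := exists_between (lt_min ht1 (lt_add_of_pos_right t hε))
        have hbl := hb2.trans_le (min_le_left _ _)
        have hbr := hb2.trans_le (min_le_right _ _)
        obtain ⟨c, hc, hc'⟩ := exists_hasDerivAt_eq_slope γ₁ g1 hb1
          (c1.mono (Icc_subset_Icc ht.1 hbl.le))
          (fun x hx => hd _ hγ₁ x ⟨ht0.trans hx.1, hx.2.trans hbl⟩)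
        refine ⟨c, ⟨(ht0.trans hc.1).le, (hc.2.trans hbl).le⟩, mul_pos ?_ ?_⟩
        · refine sub_pos.2 (hb ?_)
          rw [Real.dist_eq, abs_of_pos (sub_pos.2 hc.1)]
          linarith [hc.2]
        · rw [hc']
          exact div_pos (sub_pos.2 (hstrict₁ ht ⟨(ht0.trans hb1).le, hbl.le⟩ hb1)) (sub_pos.2 hb1)
    have i1 := ii (fun t => γ₂ t * g1 t) (c2.mul d1)
    have i2 := ii (fun t => γ₁ t * g2 t) (c1.mul d2)
    have i3 := ii (fun t => γ₁ t * g1 t) (c1.mul d1)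
    simp only [mul_comm (g1 _), sub_mul] at e1 e2 e3
    rw [intervalIntegral.integral_add i1 i2] at e1
    rw [intervalIntegral.integral_add i3 i3] at e2
    rw [intervalIntegral.integral_sub i3 i1] at e3
    linarith
  · have : ∫ t in (0:ℝ)..1, t * derivWithin (fun s : ℝ => s) (Icc (0:ℝ) 1) t
        = ∫ t in (0:ℝ)..1, t := by
      apply intervalIntegral.integral_congr
      intro x hx
      rw [uIcc_of_le zero_le_one] at hx
      have := derivWithin_id' x _ (hU x hx)
      simp only [this, mul_one]
    rw [this, integral_id]
    norm_num
end
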